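/- The value function h ↦ V(h) := sup_σ R(σ, h), where the supremum is over all behavior strategies σ in G_h, is nondecreasing on (0, 1]. -/

import Mathlib

open Filter

/-- A POMDP (data only): deterministic signal map `f`, stage payoff `g`,
transition kernel `P`, and initial distribution `p1`. -/
structure POMDP (Ω A S : Type*) where
  f : Ω → S
  g : Ω → A → ℝ
  P : Ω → A → Ω → ℝ
  p1 : Ω → ℝ

/-- A history `(s₁, a₁, …, a_{t-1}, s_t)`, encoded as the reversed list of past
(signal, action) pairs together with the current signal. -/
abbrev Hist (S A : Type*) := List (S × A) × S

/-- A behavior strategy (data only): a mixed action for every finite history. -/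
abbrev Strategy (S A : Type*) := Hist S A → A → ℝ

/-- `σ η ∈ Δ(A)` for every history `η`. -/
def IsStrategy {S A : Type*} [Fintype A] (σ : Strategy S A) : Prop :=
  (∀ η a, 0 ≤ σ η a) ∧ ∀ η, ∑ a, σ η a = 1

namespace POMDP

variable {Ω A S : Type*} [Fintype Ω] [Fintype A]

/-- `P ω a ∈ Δ(Ω)` for every `(ω, a)`, and `p1 ∈ Δ(Ω)`. -/
def IsValid (M : POMDP Ω A S) : Prop :=
  (∀ ω a ω', 0 ≤ M.P ω a ω') ∧ (∀ ω a, ∑ ω', M.P ω a ω' = 1) ∧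
    (∀ ω, 0 ≤ M.p1 ω) ∧ ∑ ω, M.p1 ω = 1

/-- The observable history determined by a reversed past trajectory and the
current state. -/
def obs (M : POMDP Ω A S) (rev : List (Ω × A)) (ω : Ω) : Hist S A :=
  (rev.map fun p => (M.f p.1, p.2), M.f ω)

/-- Probability of a finite trajectory `(ω₁, a₁, …, ω_t, a_t)` under a strategy,
the trajectory being given in reverse order (the head of the list is the most
recent (state, action) pair). -/
def trajP (M : POMDP Ω A S) (σ : Strategy S A) : List (Ω × A) → ℝ
  | [] => 1
  | (ω, a) :: rest =>
      (match rest with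
        | [] => M.p1 ω
        | (ω', a') :: _ => M.P ω' a' ω) *
        σ (M.obs rest ω) a * trajP M σ rest

/-- The expected stage-`(n+1)` payoff `E_σ[g(ω_{n+1}, a_{n+1})]`. -/
noncomputable def stageE (M : POMDP Ω A S) (σ : Strategy S A) (n : ℕ) : ℝ :=
  ∑ tr : Fin (n + 1) → Ω × A, trajP M σ (List.ofFn tr) * M.g (tr 0).1 (tr 0).2

/-- The expected long-run average payoff
`R(σ) = liminf_T E_σ[(1/T) ∑_{i=1}^T g(ω_i, a_i)]`. -/
noncomputable def R (M : POMDP Ω A S) (σ : Strategy S A) : ℝ :=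
  liminf (fun T : ℕ => (1 / (T : ℝ)) * ∑ n ∈ Finset.range T, stageE M σ n) atTop

/-- The POMDP `G_h` with stage duration `h`:
`P_h(⬝|ω,a) = h·P(⬝|ω,a) + (1-h)·δ_ω`. -/
def dur [DecidableEq Ω] (M : POMDP Ω A S) (h : ℝ) : POMDP Ω A S :=
  { M with P := fun ω a ω' => h * M.P ω a ω' + (1 - h) * (if ω' = ω then 1 else 0) }

/-- The asymptotic value `V(h) = sup_σ R(σ, h)` of `G_h`. -/
noncomputable def V [DecidableEq Ω] (M : POMDP Ω A S) (h : ℝ) : ℝ :=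
  sSup {r | ∃ σ : Strategy S A, IsStrategy σ ∧ r = (M.dur h).R σ}

end POMDP

/-- The probability that a binomial variable with parameters `t` and `p` equals `j`, defined through
Pascal's recursion. -/
def binomialWeight (p : ℝ) : ℕ → ℕ → ℝ
  | 0, 0 => 1
  | 0, _ + 1 => 0
  | t + 1, 0 => (1 - p) * binomialWeight p t 0
  | t + 1, j + 1 => (1 - p) * binomialWeight p t (j + 1) + p * binomialWeight p t j

namespace binomialWeight

variable {p : ℝ}

lemma nonneg (hp0 : 0 ≤ p) (hp1 : p ≤ 1) (t j : ℕ) : 0 ≤ binomialWeight p t j := by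
  have h1 : 0 ≤ 1 - p := by linarith
  induction t generalizing j with
  | zero => cases j <;> simp [binomialWeight]
  | succ t ih =>
    cases j with
    | zero => exact mul_nonneg h1 (ih 0)
    | succ j => exact add_nonneg (mul_nonneg h1 (ih _)) (mul_nonneg hp0 (ih _))

lemma eq_zero_of_lt (p : ℝ) {t j : ℕ} (h : t < j) : binomialWeight p t j = 0 := by
  induction t generalizing j with
  | zero => obtain ⟨j, rfl⟩ := Nat.exists_eq_succ_of_ne_zero h.ne'; rfl
  | succ t ih =>
    obtain ⟨j, rfl⟩ := Nat.exists_eq_succ_of_ne_zero (by omega : j ≠ 0)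
    simp [binomialWeight, ih (by omega : t < j + 1), ih (by omega : t < j)]

/-- Conditioning the expectation of `φ` on the last of the `t + 1` trials. -/
lemma sum_succ (p : ℝ) {t N : ℕ} (hN : t < N) (φ : ℕ → ℝ) :
    ∑ j ∈ Finset.range (N + 1), binomialWeight p (t + 1) j * φ j =
      (1 - p) * ∑ j ∈ Finset.range N, binomialWeight p t j * φ j +
        p * ∑ j ∈ Finset.range N, binomialWeight p t j * φ (j + 1) := by
  have h : ∑ j ∈ Finset.range N, binomialWeight p t j * φ j =
      ∑ j ∈ Finset.range N, binomialWeight p t (j + 1) * φ (j + 1) +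
        binomialWeight p t 0 * φ 0 := by
    rw [← Finset.sum_range_succ' (fun j => binomialWeight p t j * φ j),
      Finset.sum_range_succ, eq_zero_of_lt p hN]
    simp
  rw [Finset.sum_range_succ', h, mul_add, Finset.mul_sum, Finset.mul_sum]
  simp only [binomialWeight, add_mul, Finset.sum_add_distrib, mul_assoc]
  ring

lemma sum_eq_one (p : ℝ) {t N : ℕ} (hN : t < N) :
    ∑ j ∈ Finset.range N, binomialWeight p t j = 1 := by
  induction t generalizing N with
  | zero =>
    obtain ⟨N, rfl⟩ := Nat.exists_eq_succ_of_ne_zero hN.ne'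
    rw [Finset.sum_range_succ']
    simp [binomialWeight]
  | succ t ih =>
    obtain ⟨N, rfl⟩ := Nat.exists_eq_succ_of_ne_zero (by omega : N ≠ 0)
    have h := sum_succ p (by omega : t < N) (fun _ => 1)
    simp only [mul_one, ih (by omega : t < N)] at h
    rw [h]; ring

lemma sum_mul_sub_sq (p c : ℝ) {t N : ℕ} (hN : t < N) :
    ∑ j ∈ Finset.range N, binomialWeight p t j * ((j : ℝ) - c) ^ 2 =
      t * p * (1 - p) + (t * p - c) ^ 2 := by
  induction t generalizing N c with
  | zero =>
    obtain ⟨N, rfl⟩ := Nat.exists_eq_succ_of_ne_zero hN.ne'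
    rw [Finset.sum_range_succ']
    simp [binomialWeight]
  | succ t ih =>
    obtain ⟨N, rfl⟩ := Nat.exists_eq_succ_of_ne_zero (by omega : N ≠ 0)
    have hN' : t < N := by omega
    have h := ih (c - 1) hN'
    rw [Finset.sum_congr rfl (fun (j : ℕ) _ => by
      rw [show (j : ℝ) - (c - 1) = ((j + 1 : ℕ) : ℝ) - c by push_cast; ring])] at h
    rw [sum_succ p hN' (fun j => ((j : ℝ) - c) ^ 2), ih c hN', h]
    push_cast
    ring

lemma hasSum (hp0 : 0 < p) (hp1 : p ≤ 1) (j : ℕ) :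
    HasSum (fun t => binomialWeight p t j) p⁻¹ := by
  have hn := nonneg hp0.le hp1
  induction j with
  | zero =>
    have h : (fun t => binomialWeight p t 0) = fun t => (1 - p) ^ t := by
      funext t
      induction t with
      | zero => simp [binomialWeight]
      | succ t ih => rw [binomialWeight, ih, pow_succ']
    rw [h]
    simpa using hasSum_geometric_of_lt_one (by linarith : 0 ≤ 1 - p) (by linarith)
  | succ j ih =>
    have hpart : ∀ T, ∑ t ∈ Finset.range (T + 1), binomialWeight p t (j + 1) =
        (1 - p) * ∑ t ∈ Finset.range T, binomialWeight p t (j + 1) +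
          p * ∑ t ∈ Finset.range T, binomialWeight p t j := by
      intro T
      rw [Finset.sum_range_succ']
      simp [binomialWeight, Finset.sum_add_distrib, Finset.mul_sum]
    have hs : Summable fun t => binomialWeight p t (j + 1) := by
      refine summable_of_sum_range_le (c := p⁻¹) (fun t => hn t _) fun T => ?_
      have h1 := hpart T
      rw [Finset.sum_range_succ] at h1
      have h2 : ∑ t ∈ Finset.range T, binomialWeight p t j ≤ p⁻¹ :=
        sum_le_hasSum _ (fun t _ => hn t j) ih
      have h3 := hn T (j + 1)
      have h4 : p * ∑ t ∈ Finset.range T, binomialWeight p t (j + 1) ≤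
          p * ∑ t ∈ Finset.range T, binomialWeight p t j := by linarith
      exact (le_of_mul_le_mul_left h4 hp0).trans h2
    have h1 := hs.tsum_eq_zero_add
    have h2 : ∑' t, binomialWeight p (t + 1) (j + 1) =
        (1 - p) * (∑' t, binomialWeight p t (j + 1)) + p * p⁻¹ :=
      ((hs.hasSum.mul_left (1 - p)).add (ih.mul_left p)).tsum_eq
    have h3 : ∑' t, binomialWeight p t (j + 1) = p⁻¹ := by
      rw [h2] at h1
      simp only [binomialWeight, zero_add] at h1
      exact mul_left_cancel₀ hp0.ne' (by linarith)
    exact h3 ▸ hs.hasSum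

/-- The expected number of stages before `T` at which at least `m` successes have occurred. -/
lemma mul_sum_tail (p : ℝ) (m : ℕ) {T N : ℕ} (hN : T < N) :
    p * ∑ t ∈ Finset.range T, ∑ j ∈ Finset.range N,
        binomialWeight p t j * (if m ≤ j then 1 else 0) =
      ∑ j ∈ Finset.range N, binomialWeight p T j * ((j - m : ℕ) : ℝ) := by
  induction T with
  | zero =>
    obtain ⟨N, rfl⟩ := Nat.exists_eq_succ_of_ne_zero hN.ne'
    rw [Finset.sum_range_succ']
    simp [binomialWeight]
  | succ T ih =>
    obtain ⟨N, rfl⟩ := Nat.exists_eq_succ_of_ne_zero (by omega : N ≠ 0)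
    have hz := eq_zero_of_lt p (by omega : T < N)
    have h1 : ∀ j, ((j + 1 - m : ℕ) : ℝ) = ((j - m : ℕ) : ℝ) + if m ≤ j then 1 else 0 := by
      intro j
      split_ifs with h
      · rw [Nat.succ_sub h]; push_cast; ring
      · simp [Nat.sub_eq_zero_of_le (by omega : j + 1 ≤ m),
          Nat.sub_eq_zero_of_le (by omega : j ≤ m)]
    rw [Finset.sum_range_succ, mul_add, ih (by omega),
      sum_succ p (by omega : T < N) (fun j => ((j - m : ℕ) : ℝ))]
    simp only [h1, mul_add, Finset.sum_add_distrib]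
    rw [Finset.sum_range_succ _ N, Finset.sum_range_succ _ N, hz]
    ring

lemma mul_sum_tail_le (hp0 : 0 ≤ p) (hp1 : p ≤ 1) {m : ℕ} (hm : 0 < m) {T N : ℕ}
    (hN : T < N) (hT1 : (m : ℝ) ≤ T * p) (hT2 : T * p ≤ m + 1) :
    p * ∑ t ∈ Finset.range T, ∑ j ∈ Finset.range N,
        binomialWeight p t j * (if m ≤ j then 1 else 0) ≤ 4 * √m := by
  have hn := nonneg hp0 hp1
  have hm1 : (1 : ℝ) ≤ m := by exact_mod_cast hm
  have hs : 1 ≤ √(m : ℝ) := Real.one_le_sqrt.2 hm1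
  have hsq : √(m : ℝ) ^ 2 = m := Real.sq_sqrt (by linarith)
  rw [mul_sum_tail p m hN]
  calc ∑ j ∈ Finset.range N, binomialWeight p T j * ((j - m : ℕ) : ℝ)
      ≤ ∑ j ∈ Finset.range N,
          ((√(m : ℝ))⁻¹ * (binomialWeight p T j * ((j : ℝ) - m) ^ 2) +
            √(m : ℝ) * binomialWeight p T j) := by
        refine Finset.sum_le_sum fun j _ => ?_
        have h : ((j - m : ℕ) : ℝ) ≤ (√(m : ℝ))⁻¹ * ((j : ℝ) - m) ^ 2 + √(m : ℝ) := by
          rcases le_total m j with h | h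
          · rw [Nat.cast_sub h, ← mul_le_mul_iff_right₀ (by linarith : 0 < √(m : ℝ)), mul_add,
              ← mul_assoc, mul_inv_cancel₀ (by linarith), one_mul]
            nlinarith [sq_nonneg ((j : ℝ) - m - √(m : ℝ)), sq_nonneg ((j : ℝ) - m + √(m : ℝ))]
          · rw [Nat.sub_eq_zero_of_le h]
            push_cast
            positivity
        calc _ ≤ binomialWeight p T j * _ := mul_le_mul_of_nonneg_left h (hn T j)
          _ = _ := by ring
    _ = (√(m : ℝ))⁻¹ * (T * p * (1 - p) + (T * p - m) ^ 2) + √(m : ℝ) := by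
        rw [Finset.sum_add_distrib, ← Finset.mul_sum, ← Finset.mul_sum, sum_mul_sub_sq p m hN,
          sum_eq_one p hN, mul_one]
    _ ≤ (√(m : ℝ))⁻¹ * (3 * √(m : ℝ) ^ 2) + √(m : ℝ) := by
        have h1 : T * p * (1 - p) ≤ m + 1 := by nlinarith [mul_nonneg (by linarith : 0 ≤ T * p) hp0]
        have h2 : (T * p - m) ^ 2 ≤ 1 := by nlinarith
        gcongr
        linarith
    _ = 4 * √m := by field_simp; ring

end binomialWeight

/-- If the terms `a j t` are dominated by binomial weights, the partial sums over `t` of the column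
sums and over `j` of the row sums agree up to an error of order `√m`. -/
lemma abs_sum_sub_sum_le {p C : ℝ} (hp0 : 0 < p) (hp1 : p ≤ 1) {a : ℕ → ℕ → ℝ}
    {x y : ℕ → ℝ} (ha : ∀ j t, |a j t| ≤ C * binomialWeight p t j)
    (hx : ∀ t, x t = ∑ j ∈ Finset.range (t + 1), a j t)
    (hy : ∀ j, HasSum (fun t => p * a j t) (y j)) {m : ℕ} (hm : 0 < m) {T : ℕ}
    (hT1 : (m : ℝ) ≤ T * p) (hT2 : T * p ≤ m + 1) :
    |∑ j ∈ Finset.range m, y j - p * ∑ t ∈ Finset.range T, x t| ≤ C * (8 * √m) := by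
  have hn := binomialWeight.nonneg hp0.le hp1
  have hC : 0 ≤ C := by
    have h := (abs_nonneg _).trans (ha 0 0)
    simpa [binomialWeight] using h
  set N := T + m + 1 with hN
  have hxN : ∀ t ∈ Finset.range T, x t = ∑ j ∈ Finset.range N, a j t := by
    intro t ht
    rw [hx]
    refine Finset.sum_subset (Finset.range_subset_range.2 (by
      have := Finset.mem_range.1 ht; omega)) fun j _ hj => ?_
    have h := ha j t
    rw [binomialWeight.eq_zero_of_lt p (by simpa using hj), mul_zero] at h
    exact abs_eq_zero.1 (le_antisymm h (abs_nonneg _))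
  have hsplit : ∀ (b : ℕ → ℝ), ∑ j ∈ Finset.range N, b j = ∑ j ∈ Finset.range m, b j +
      ∑ j ∈ Finset.range N, (if m ≤ j then b j else 0) := by
    intro b
    rw [← Finset.sum_range_add_sum_Ico b (by omega : m ≤ N), ← Finset.sum_filter]
    congr 2
    ext j
    simp [and_comm]
  have hrow : ∀ j, |y j - p * ∑ t ∈ Finset.range T, a j t| ≤
      C * (1 - p * ∑ t ∈ Finset.range T, binomialWeight p t j) := by
    intro j
    have h1 := (hasSum_nat_add_iff' T).2 (hy j)
    have h2 := (hasSum_nat_add_iff' T).2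
      ((binomialWeight.hasSum hp0 hp1 j).mul_left (C * p))
    rw [← Finset.mul_sum] at h1 h2
    have h3 : C * p * p⁻¹ - C * p * ∑ t ∈ Finset.range T, binomialWeight p t j =
        C * (1 - p * ∑ t ∈ Finset.range T, binomialWeight p t j) := by
      field_simp
    rw [h3] at h2
    have h4 : ∀ t, |p * a j (t + T)| ≤ C * p * binomialWeight p (t + T) j := fun t => by
      rw [abs_mul, abs_of_pos hp0]
      nlinarith [ha j (t + T)]
    refine abs_le.2 ⟨?_, hasSum_le (fun t => (abs_le.1 (h4 t)).2) h1 h2⟩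
    exact hasSum_le (fun t => (abs_le.1 (h4 t)).1) h2.neg h1
  have htail := binomialWeight.mul_sum_tail_le hp0.le hp1 hm (by omega : T < N) hT1 hT2
  set D := ∑ t ∈ Finset.range T, ∑ j ∈ Finset.range N,
    binomialWeight p t j * (if m ≤ j then 1 else 0) with hD
  have hcount : (T : ℝ) = ∑ j ∈ Finset.range m, ∑ t ∈ Finset.range T, binomialWeight p t j + D := by
    rw [Finset.sum_comm, hD, ← Finset.sum_add_distrib]
    calc (T : ℝ) = ∑ t ∈ Finset.range T, 1 := by simp
      _ = _ := Finset.sum_congr rfl fun t ht => by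
        have h := binomialWeight.sum_eq_one p (t := t) (N := N) (by
          have := Finset.mem_range.1 ht; omega)
        rw [hsplit] at h
        simpa using h.symm
  have hcol : |∑ t ∈ Finset.range T, ∑ j ∈ Finset.range N, (if m ≤ j then a j t else 0)| ≤
      C * D := by
    rw [hD, Finset.mul_sum]
    refine (Finset.abs_sum_le_sum_abs _ _).trans (Finset.sum_le_sum fun t _ => ?_)
    rw [Finset.mul_sum]
    refine (Finset.abs_sum_le_sum_abs _ _).trans (Finset.sum_le_sum fun j _ => ?_)
    split_ifs
    · simpa using ha j t
    · simp
  have hdecomp : ∑ j ∈ Finset.range m, y j - p * ∑ t ∈ Finset.range T, x t =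
      ∑ j ∈ Finset.range m, (y j - p * ∑ t ∈ Finset.range T, a j t) -
        p * ∑ t ∈ Finset.range T, ∑ j ∈ Finset.range N, (if m ≤ j then a j t else 0) := by
    rw [Finset.sum_congr rfl hxN, Finset.sum_congr rfl fun t _ => hsplit fun j => a j t,
      Finset.sum_add_distrib, Finset.sum_comm (s := Finset.range T) (t := Finset.range m),
      Finset.sum_sub_distrib, ← Finset.mul_sum]
    ring
  have hrows : |∑ j ∈ Finset.range m, (y j - p * ∑ t ∈ Finset.range T, a j t)| ≤
      C * (m - p * (T - D)) := by
    refine (Finset.abs_sum_le_sum_abs _ _).trans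
      ((Finset.sum_le_sum fun j _ => hrow j).trans (le_of_eq ?_))
    rw [← Finset.mul_sum, Finset.sum_sub_distrib, ← Finset.mul_sum, hcount]
    simp
  rw [hdecomp]
  calc _ ≤ _ := abs_sub _ _
    _ ≤ C * (m - p * (T - D)) + p * (C * D) := by
      rw [abs_mul, abs_of_pos hp0]
      gcongr
    _ = C * (m - T * p + 2 * (p * D)) := by ring
    _ ≤ C * (8 * √m) := by gcongr; linarith

lemma abs_average_le {x : ℕ → ℝ} {C : ℝ} (hC : 0 ≤ C) (hx : ∀ t, |x t| ≤ C) (T : ℕ) :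
    |(1 / (T : ℝ)) * ∑ t ∈ Finset.range T, x t| ≤ C := by
  rcases Nat.eq_zero_or_pos T with rfl | hT
  · simpa
  have hT' : (0 : ℝ) < T := by exact_mod_cast hT
  rw [abs_mul, abs_of_pos (by positivity), one_div, inv_mul_le_iff₀ hT']
  refine (Finset.abs_sum_le_sum_abs _ _).trans ((Finset.sum_le_sum fun t _ => hx t).trans ?_)
  simp

lemma liminf_average_le {p C : ℝ} (hp0 : 0 < p) (hp1 : p ≤ 1) {a : ℕ → ℕ → ℝ}
    {x y : ℕ → ℝ} (ha : ∀ j t, |a j t| ≤ C * binomialWeight p t j)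
    (hx : ∀ t, x t = ∑ j ∈ Finset.range (t + 1), a j t) (hxC : ∀ t, |x t| ≤ C)
    (hy : ∀ j, HasSum (fun t => p * a j t) (y j)) :
    liminf (fun T : ℕ => (1 / (T : ℝ)) * ∑ t ∈ Finset.range T, x t) atTop ≤
      liminf (fun m : ℕ => (1 / (m : ℝ)) * ∑ j ∈ Finset.range m, y j) atTop := by
  have hC : 0 ≤ C := (abs_nonneg _).trans (hxC 0)
  set c := fun T : ℕ => (1 / (T : ℝ)) * ∑ t ∈ Finset.range T, x t with hc
  set d := fun m : ℕ => (1 / (m : ℝ)) * ∑ j ∈ Finset.range m, y j with hd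
  have hcC : ∀ T, |c T| ≤ C := abs_average_le hC hxC
  let τ : ℕ → ℕ := fun m => ⌈(m : ℝ) / p⌉₊
  have hτ1 : ∀ m : ℕ, (m : ℝ) ≤ τ m * p := fun m => (div_le_iff₀ hp0).1 (Nat.le_ceil _)
  have hτ2 : ∀ m : ℕ, (τ m : ℝ) * p ≤ m + 1 := fun m => by
    have h := (Nat.ceil_lt_add_one (by positivity : 0 ≤ (m : ℝ) / p)).le
    calc (τ m : ℝ) * p ≤ ((m : ℝ) / p + 1) * p := by gcongr
      _ = m + p := by field_simp
      _ ≤ m + 1 := by linarith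
  have hτ : Tendsto τ atTop atTop :=
    tendsto_nat_ceil_atTop.comp
      (tendsto_natCast_atTop_atTop.atTop_div_const hp0)
  have hbound : ∀ m : ℕ, 0 < m → |d m - c (τ m)| ≤ 9 * C * (√(m : ℝ))⁻¹ := by
    intro m hm
    have hm0 : (1 : ℝ) ≤ m := by exact_mod_cast hm
    have hs : 1 ≤ √(m : ℝ) := Real.one_le_sqrt.2 hm0
    have hsq : √(m : ℝ) ^ 2 = m := Real.sq_sqrt (by linarith)
    have h1 := abs_sum_sub_sum_le hp0 hp1 ha hx hy hm (hτ1 m) (hτ2 m)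
    have hτ0 : (0 : ℝ) < τ m := by
      have := hτ1 m
      by_contra h
      nlinarith
    have hsum : ∑ t ∈ Finset.range (τ m), x t = τ m * c (τ m) := by
      simp only [hc]; field_simp
    have hsumd : ∑ j ∈ Finset.range m, y j = m * d m := by
      simp only [hd]; field_simp
    rw [hsum, hsumd] at h1
    have h2 : |(τ m * p - m) * c (τ m)| ≤ C := by
      rw [abs_mul, abs_of_nonneg (by linarith [hτ1 m])]
      calc _ ≤ 1 * C := by
            gcongr
            · linarith [hτ2 m]
            · exact hcC _
        _ = C := one_mul C
    have h3 : m * |d m - c (τ m)| ≤ 9 * C * √m := by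
      have hm' : (0 : ℝ) < m := by linarith
      rw [← abs_of_pos hm', ← abs_mul, abs_of_pos hm']
      calc |(m : ℝ) * (d m - c (τ m))|
          = |(m * d m - p * (τ m * c (τ m))) + (τ m * p - m) * c (τ m)| := by congr 1; ring
        _ ≤ C * (8 * √m) + C := (abs_add_le _ _).trans (add_le_add h1 h2)
        _ ≤ 9 * C * √m := by nlinarith
    have h4 : (√(m : ℝ)) * |d m - c (τ m)| ≤ 9 * C := by
      refine le_of_mul_le_mul_left ?_ (by linarith : 0 < √(m : ℝ))
      calc _ = m * |d m - c (τ m)| := by rw [← mul_assoc, ← sq, hsq]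
        _ ≤ _ := h3
        _ = _ := by ring
    rw [← div_eq_mul_inv, le_div_iff₀ (by linarith)]
    linarith
  have hlim : Tendsto (fun m : ℕ => d m - c (τ m)) atTop (nhds 0) := by
    refine squeeze_zero_norm' (a := fun m : ℕ => 9 * C * (√(m : ℝ))⁻¹) ?_ ?_
    · filter_upwards [eventually_gt_atTop 0] with m hm using hbound m hm
    · simpa using ((tendsto_inv_atTop_zero.comp
        (Real.tendsto_sqrt_atTop.comp tendsto_natCast_atTop_atTop)).const_mul (9 * C))
  have hcb : IsBoundedUnder (· ≤ ·) atTop c := isBoundedUnder_of ⟨C, fun T => (abs_le.1 (hcC T)).2⟩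
  have hcb' : IsBoundedUnder (· ≥ ·) atTop c :=
    isBoundedUnder_of ⟨-C, fun T => (abs_le.1 (hcC T)).1⟩
  have hdC : ∀ᶠ m in atTop, |d m| ≤ C + 1 := by
    filter_upwards [hlim.abs.eventually_le_const (by simp : |(0 : ℝ)| < 1)] with m hm
    have h := abs_add_le (d m - c (τ m)) (c (τ m))
    rw [sub_add_cancel] at h
    linarith [hcC (τ m)]
  have hdb : IsCoboundedUnder (· ≥ ·) atTop d :=
    IsBoundedUnder.isCoboundedUnder_ge
      ⟨C + 1, eventually_map.2 (hdC.mono fun m hm => (abs_le.1 hm).2)⟩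
  refine le_of_forall_lt fun b hb => ?_
  obtain ⟨b', hbb', hb'⟩ := exists_between hb
  obtain ⟨b'', hb'b'', hb''⟩ := exists_between hb'
  refine hbb'.trans_le (le_liminf_of_le hdb ?_)
  filter_upwards [hτ.eventually (eventually_lt_of_lt_liminf hb'' hcb'),
    hlim.eventually_const_le (by linarith : b' - b'' < 0)] with m h1 h2
  linarith

section Strategy

variable {A S : Type*} [Fintype A]

/-- Suppose every stage of a play under `σ` is independently marked with probability `p`, and that
the signal can only change after a marked stage. Up to the factor given by the transitions,
`hiddenExpect p σ t l s φ` is the expectation of `φ` at the history of the first `t` stages, on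
the event that the marked ones among them form the history `l` and that the next signal is `s`. -/
def hiddenExpect (p : ℝ) (σ : Strategy S A) :
    ℕ → List (S × A) → S → (List (S × A) → ℝ) → ℝ
  | 0, [], _, φ => φ []
  | 0, _ :: _, _, _ => 0
  | t + 1, [], s, φ =>
      (1 - p) * hiddenExpect p σ t [] s (fun m => ∑ a, σ (m, s) a * φ ((s, a) :: m))
  | t + 1, x :: l, s, φ =>
      (1 - p) * hiddenExpect p σ t (x :: l) s (fun m => ∑ a, σ (m, s) a * φ ((s, a) :: m)) +
        p * hiddenExpect p σ t l x.1 (fun m => σ (m, x.1) x.2 * φ (x :: m))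

variable {p : ℝ} {σ : Strategy S A}

lemma IsStrategy.le_one (hσ : IsStrategy σ) (η : Hist S A) (a : A) : σ η a ≤ 1 :=
  hσ.2 η ▸ Finset.single_le_sum (fun b _ => hσ.1 η b) (Finset.mem_univ a)

lemma IsStrategy.abs_sum_mul_le (hσ : IsStrategy σ) (η : Hist S A) {φ : A → ℝ} {C : ℝ}
    (hφ : ∀ a, |φ a| ≤ C) : |∑ a, σ η a * φ a| ≤ C := by
  refine (Finset.abs_sum_le_sum_abs _ _).trans ?_
  calc ∑ a, |σ η a * φ a| ≤ ∑ a, σ η a * C := Finset.sum_le_sum fun a _ => by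
        rw [abs_mul, abs_of_nonneg (hσ.1 η a)]
        exact mul_le_mul_of_nonneg_left (hφ a) (hσ.1 η a)
    _ = C := by rw [← Finset.sum_mul, hσ.2, one_mul]

lemma hiddenExpect_sum {ι : Type*} (I : Finset ι) (c : ι → ℝ) (φ : ι → List (S × A) → ℝ)
    (t : ℕ) (l : List (S × A)) (s : S) :
    hiddenExpect p σ t l s (fun m => ∑ i ∈ I, c i * φ i m) =
      ∑ i ∈ I, c i * hiddenExpect p σ t l s (φ i) := by
  induction t generalizing l s φ with
  | zero => cases l <;> simp [hiddenExpect]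
  | succ t ih =>
    have hstay : (fun m => ∑ a, σ (m, s) a * ∑ i ∈ I, c i * φ i ((s, a) :: m)) =
        fun m => ∑ i ∈ I, c i * ∑ a, σ (m, s) a * φ i ((s, a) :: m) := by
      funext m
      simp only [Finset.mul_sum]
      rw [Finset.sum_comm]
      exact Finset.sum_congr rfl fun _ _ => Finset.sum_congr rfl fun _ _ => by ring
    cases l with
    | nil =>
      simp only [hiddenExpect]
      rw [hstay, ih, Finset.mul_sum]
      exact Finset.sum_congr rfl fun _ _ => by ring
    | cons x l =>
      have hmove : (fun m => σ (m, x.1) x.2 * ∑ i ∈ I, c i * φ i (x :: m)) =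
          fun m => ∑ i ∈ I, c i * (σ (m, x.1) x.2 * φ i (x :: m)) := by
        funext m
        rw [Finset.mul_sum]
        exact Finset.sum_congr rfl fun _ _ => by ring
      simp only [hiddenExpect]
      rw [hstay, hmove, ih, ih, Finset.mul_sum, Finset.mul_sum, ← Finset.sum_add_distrib]
      exact Finset.sum_congr rfl fun _ _ => by ring

lemma hiddenExpect_nonneg (hp0 : 0 ≤ p) (hp1 : p ≤ 1) (hσ : IsStrategy σ)
    {φ : List (S × A) → ℝ} (hφ : ∀ m, 0 ≤ φ m) (t : ℕ) (l : List (S × A)) (s : S) :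
    0 ≤ hiddenExpect p σ t l s φ := by
  have hq : 0 ≤ 1 - p := by linarith
  induction t generalizing l s φ with
  | zero => cases l <;> simp [hiddenExpect, hφ]
  | succ t ih =>
    have hstay : ∀ m, 0 ≤ ∑ a, σ (m, s) a * φ ((s, a) :: m) := fun m =>
      Finset.sum_nonneg fun a _ => mul_nonneg (hσ.1 _ _) (hφ _)
    cases l with
    | nil => exact mul_nonneg hq (ih hstay _ _)
    | cons x l =>
      exact add_nonneg (mul_nonneg hq (ih hstay _ _))
        (mul_nonneg hp0 (ih (fun m => mul_nonneg (hσ.1 _ _) (hφ _)) _ _))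

lemma abs_hiddenExpect_le (hp0 : 0 ≤ p) (hp1 : p ≤ 1) (hσ : IsStrategy σ)
    {φ : List (S × A) → ℝ} {C : ℝ} (hφ : ∀ m, |φ m| ≤ C) (t : ℕ) (l : List (S × A)) (s : S) :
    |hiddenExpect p σ t l s φ| ≤ C * binomialWeight p t l.length := by
  have hq : 0 ≤ 1 - p := by linarith
  induction t generalizing l s φ with
  | zero => cases l <;> simp [hiddenExpect, binomialWeight, hφ]
  | succ t ih =>
    have hstay := fun l => mul_le_mul_of_nonneg_left
      (ih (fun m => hσ.abs_sum_mul_le (m, s) fun a => hφ ((s, a) :: m)) l s) hq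
    cases l with
    | nil =>
      rw [hiddenExpect, abs_mul, abs_of_nonneg hq]
      exact (hstay []).trans (le_of_eq (by simp only [List.length_nil, binomialWeight]; ring))
    | cons x l =>
      have hmove : ∀ m, |σ (m, x.1) x.2 * φ (x :: m)| ≤ C := fun m => by
        rw [abs_mul, abs_of_nonneg (hσ.1 _ _)]
        exact (mul_le_of_le_one_left (abs_nonneg _) (hσ.le_one _ _)).trans (hφ _)
      rw [hiddenExpect]
      refine (abs_add_le _ _).trans ?_
      rw [abs_mul, abs_mul, abs_of_nonneg hq, abs_of_nonneg hp0]
      refine (add_le_add (hstay (x :: l))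
        (mul_le_mul_of_nonneg_left (ih hmove l x.1) hp0)).trans (le_of_eq ?_)
      simp only [List.length_cons, binomialWeight]
      ring

/-- The total `hiddenExpect` over all numbers of stages. -/
noncomputable def occupation (p : ℝ) (σ : Strategy S A) (l : List (S × A)) (s : S)
    (φ : List (S × A) → ℝ) : ℝ :=
  ∑' t, hiddenExpect p σ t l s φ

lemma hasSum_occupation (hp0 : 0 < p) (hp1 : p ≤ 1) (hσ : IsStrategy σ)
    {φ : List (S × A) → ℝ} {C : ℝ} (hφ : ∀ m, |φ m| ≤ C) (l : List (S × A)) (s : S) :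
    HasSum (fun t => hiddenExpect p σ t l s φ) (occupation p σ l s φ) :=
  (Summable.of_norm_bounded ((binomialWeight.hasSum hp0 hp1 l.length).summable.mul_left C)
    fun t => abs_hiddenExpect_le hp0.le hp1 hσ hφ t l s).hasSum

lemma IsStrategy.abs_le_one (hσ : IsStrategy σ) (η : Hist S A) (a : A) : |σ η a| ≤ 1 :=
  abs_le.2 ⟨by linarith [hσ.1 η a], hσ.le_one η a⟩

lemma occupation_sum_mul (hp0 : 0 < p) (hp1 : p ≤ 1) (hσ : IsStrategy σ)
    (l : List (S × A)) (s : S) (c : A → ℝ) :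
    HasSum (fun t => hiddenExpect p σ t l s (fun m => ∑ a, σ (m, s) a * c a))
      (∑ a, c a * occupation p σ l s (fun m => σ (m, s) a)) := by
  have h := hasSum_sum (s := Finset.univ) fun a _ =>
    (hasSum_occupation hp0 hp1 hσ (fun m => hσ.abs_le_one (m, s) a) l s).mul_left (c a)
  simpa only [← hiddenExpect_sum, mul_comm] using h

lemma sum_occupation (hp0 : 0 < p) (hp1 : p ≤ 1) (hσ : IsStrategy σ)
    (l : List (S × A)) (s : S) :
    ∑ a, occupation p σ l s (fun m => σ (m, s) a) = occupation p σ l s 1 := by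
  have h := (occupation_sum_mul hp0 hp1 hσ l s 1).tsum_eq
  simp only [Pi.one_apply, mul_one, one_mul, hσ.2] at h
  exact h.symm

lemma occupation_nonneg (hp0 : 0 ≤ p) (hp1 : p ≤ 1) (hσ : IsStrategy σ)
    {φ : List (S × A) → ℝ} (hφ : ∀ m, 0 ≤ φ m) (l : List (S × A)) (s : S) :
    0 ≤ occupation p σ l s φ :=
  tsum_nonneg fun t => hiddenExpect_nonneg hp0 hp1 hσ hφ t l s

lemma hiddenExpect_stay_one (hσ : IsStrategy σ) (s : S) :
    (fun m => ∑ a, σ (m, s) a * (1 : List (S × A) → ℝ) ((s, a) :: m)) = 1 := by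
  funext m
  simp [hσ.2]

lemma mul_occupation_nil_one (hp0 : 0 < p) (hp1 : p ≤ 1) (hσ : IsStrategy σ) (s : S) :
    p * occupation p σ [] s 1 = 1 := by
  have hs := hasSum_occupation hp0 hp1 hσ (φ := 1) (C := 1) (by simp) [] s
  have h := hs.summable.tsum_eq_zero_add
  simp only [hiddenExpect, hiddenExpect_stay_one hσ, tsum_mul_left] at h
  change occupation p σ [] s 1 = 1 + (1 - p) * occupation p σ [] s 1 at h
  linarith

lemma occupation_cons_one (hp0 : 0 < p) (hp1 : p ≤ 1) (hσ : IsStrategy σ)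
    (x : S × A) (l : List (S × A)) (s : S) :
    occupation p σ (x :: l) s 1 = occupation p σ l x.1 (fun m => σ (m, x.1) x.2) := by
  have hs := hasSum_occupation hp0 hp1 hσ (φ := 1) (C := 1) (by simp) (x :: l) s
  have hs' := hasSum_occupation hp0 hp1 hσ (fun m => hσ.abs_le_one (m, x.1) x.2) l x.1
  have h := hs.summable.tsum_eq_zero_add
  have h' := ((hs.mul_left (1 - p)).add (hs'.mul_left p)).tsum_eq
  simp only [hiddenExpect, hiddenExpect_stay_one hσ] at h
  simp only [Pi.one_apply, mul_one, zero_add] at h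
  rw [h'] at h
  change occupation p σ (x :: l) s 1 = _ at h
  exact mul_left_cancel₀ hp0.ne' (by linarith)

/-- The strategy that plays, after a history, the average of the mixed actions of `σ` over the
hidden histories whose marked stages form that history. -/
noncomputable def markedStrategy (p : ℝ) (σ : Strategy S A) : Strategy S A := fun η a =>
  open Classical in
  if occupation p σ η.1 η.2 1 = 0 then σ η a
  else occupation p σ η.1 η.2 (fun m => σ (m, η.2) a) / occupation p σ η.1 η.2 1

lemma isStrategy_markedStrategy (hp0 : 0 < p) (hp1 : p ≤ 1) (hσ : IsStrategy σ) :
    IsStrategy (markedStrategy p σ) := by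
  refine ⟨fun η a => ?_, fun η => ?_⟩ <;> unfold markedStrategy <;> split_ifs with h
  · exact hσ.1 η a
  · exact div_nonneg (occupation_nonneg hp0.le hp1 hσ (fun m => hσ.1 _ _) _ _)
      (occupation_nonneg hp0.le hp1 hσ (fun m => zero_le_one) _ _)
  · exact hσ.2 η
  · rw [← Finset.sum_div, sum_occupation hp0 hp1 hσ, div_self h]

lemma occupation_one_mul_markedStrategy (hp0 : 0 < p) (hp1 : p ≤ 1) (hσ : IsStrategy σ)
    (l : List (S × A)) (s : S) (a : A) :
    occupation p σ l s 1 * markedStrategy p σ (l, s) a =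
      occupation p σ l s (fun m => σ (m, s) a) := by
  unfold markedStrategy
  split_ifs with h
  · have hsum := sum_occupation hp0 hp1 hσ l s
    rw [h] at hsum
    rw [h, zero_mul]
    exact ((Finset.sum_eq_zero_iff_of_nonneg fun a _ =>
      occupation_nonneg hp0.le hp1 hσ (fun m => hσ.1 _ _) l s).1 hsum a (Finset.mem_univ a)).symm
  · exact mul_div_cancel₀ _ h

end Strategy

namespace POMDP

variable {Ω A S : Type*}

/-- The probability of reaching the state `ω` after the trajectory `L`. -/
def stateP (M : POMDP Ω A S) (σ : Strategy S A) : List (Ω × A) → Ω → ℝ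
  | [], ω => M.p1 ω
  | x :: L, ω => M.trajP σ (x :: L) * M.P x.1 x.2 ω

/-- The contribution of the transitions to the probability of reaching `ω` after `L`. -/
def transP (M : POMDP Ω A S) : List (Ω × A) → Ω → ℝ
  | [], ω => M.p1 ω
  | x :: L, ω => transP M L x.1 * M.P x.1 x.2 ω

/-- The observable part of a list of (state, action) pairs. -/
abbrev obsList (M : POMDP Ω A S) (L : List (Ω × A)) : List (S × A) :=
  L.map fun x => (M.f x.1, x.2)

lemma trajP_cons (M : POMDP Ω A S) (σ : Strategy S A) (x : Ω × A) (L : List (Ω × A)) :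
    M.trajP σ (x :: L) = M.stateP σ L x.1 * σ (M.obsList L, M.f x.1) x.2 := by
  obtain ⟨ω, a⟩ := x
  cases L with
  | nil => simp [trajP, stateP, obs]
  | cons y L => simp only [trajP, stateP, obs]; ring

lemma dur_dur [DecidableEq Ω] (M : POMDP Ω A S) (h p : ℝ) : (M.dur h).dur p = M.dur (p * h) := by
  simp only [dur, mk.injEq, true_and, and_true]
  funext ω a ω'
  ring

lemma mul_transP_mul_occupation [Fintype A] (M : POMDP Ω A S) {p : ℝ} (hp0 : 0 < p)
    (hp1 : p ≤ 1) {σ : Strategy S A} (hσ : IsStrategy σ) (L : List (Ω × A)) (ω : Ω) :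
    p * (M.transP L ω * occupation p σ (M.obsList L) (M.f ω) 1) =
      M.stateP (markedStrategy p σ) L ω := by
  induction L generalizing ω with
  | nil =>
    have h := mul_occupation_nil_one hp0 hp1 hσ (M.f ω)
    calc _ = M.p1 ω * (p * occupation p σ [] (M.f ω) 1) := by
          simp only [transP, List.map_nil]; ring
      _ = _ := by rw [h, mul_one, stateP]
  | cons x L ih =>
    rw [stateP, trajP_cons, ← ih, transP,
      show M.obsList (x :: L) = (M.f x.1, x.2) :: M.obsList L from rfl,
      occupation_cons_one hp0 hp1 hσ, ← occupation_one_mul_markedStrategy hp0 hp1 hσ]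
    ring

variable [Fintype Ω]

lemma isValid_dur [DecidableEq Ω] {M : POMDP Ω A S} (hM : M.IsValid) {h : ℝ} (h0 : 0 ≤ h)
    (h1 : h ≤ 1) : (M.dur h).IsValid := by
  refine ⟨fun ω a ω' => ?_, fun ω a => ?_, hM.2.2⟩
  · have := hM.1 ω a ω'
    have h2 : 0 ≤ 1 - h := by linarith
    simp only [dur]
    split_ifs <;> positivity
  · simp only [dur, Finset.sum_add_distrib, ← Finset.mul_sum, hM.2.1]
    simp

variable [Fintype A]

/-- The sum of `F` over the lists of length `n`. -/
def listSum (n : ℕ) (F : List (Ω × A) → ℝ) : ℝ :=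
  ∑ tr : Fin n → Ω × A, F (List.ofFn tr)

lemma listSum_zero (F : List (Ω × A) → ℝ) : listSum 0 F = F [] := by
  simp [listSum]

lemma listSum_succ (n : ℕ) (F : List (Ω × A) → ℝ) :
    listSum (n + 1) F = listSum n fun L => ∑ x, F (x :: L) := by
  unfold listSum
  rw [← (Fin.consEquiv fun _ => Ω × A).sum_comp, Fintype.sum_prod_type, Finset.sum_comm]
  simp [Fin.consEquiv, List.ofFn_succ]

/-- The expectation of `ψ` at the observable history and the state reached after `t` stages. -/
def expect (M : POMDP Ω A S) (σ : Strategy S A) (t : ℕ) (ψ : List (S × A) → Ω → ℝ) : ℝ :=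
  listSum t fun L => ∑ ω, M.stateP σ L ω * ψ (M.obsList L) ω

/-- The expected stage payoff, as a function of the observable history and the state. -/
def payoff (M : POMDP Ω A S) (σ : Strategy S A) (m : List (S × A)) (ω : Ω) : ℝ :=
  ∑ a, σ (m, M.f ω) a * M.g ω a

lemma stageE_eq_expect (M : POMDP Ω A S) (σ : Strategy S A) (t : ℕ) :
    M.stageE σ t = M.expect σ t (M.payoff σ) := by
  have h : M.stageE σ t = listSum (t + 1) fun L => M.trajP σ L *
      (L.head?.map fun x => M.g x.1 x.2).getD 0 := by
    simp [stageE, listSum, List.ofFn_succ]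
  rw [h, listSum_succ, expect]
  congr 1
  funext L
  simp only [trajP_cons, payoff, List.head?_cons, Option.map_some, Option.getD_some,
    Fintype.sum_prod_type, Finset.mul_sum, mul_assoc]

/-- Expectation of `ψ` after one more stage in which the state is kept. -/
def stay (M : POMDP Ω A S) (σ : Strategy S A) (ψ : List (S × A) → Ω → ℝ) (m : List (S × A))
    (ω : Ω) : ℝ :=
  ∑ a, σ (m, M.f ω) a * ψ ((M.f ω, a) :: m) ω

/-- Expectation of `ψ` after one more stage in which the state moves according to `M.P`. -/
def move (M : POMDP Ω A S) (σ : Strategy S A) (ψ : List (S × A) → Ω → ℝ) (m : List (S × A))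
    (ω : Ω) : ℝ :=
  ∑ a, σ (m, M.f ω) a * ∑ ω', M.P ω a ω' * ψ ((M.f ω, a) :: m) ω'

lemma expect_succ (M : POMDP Ω A S) (σ : Strategy S A) (t : ℕ) (ψ : List (S × A) → Ω → ℝ) :
    M.expect σ (t + 1) ψ = M.expect σ t (M.move σ ψ) := by
  rw [expect, listSum_succ, expect]
  congr 1
  funext L
  have h : ∀ ω a ω', M.stateP σ ((ω, a) :: L) ω' =
      M.stateP σ L ω * σ (M.obsList L, M.f ω) a * M.P ω a ω' := fun ω a ω' => by
    rw [stateP, trajP_cons]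
  simp only [h, move, Fintype.sum_prod_type, Finset.mul_sum, mul_assoc, List.map_cons]

lemma move_dur [DecidableEq Ω] (M : POMDP Ω A S) (σ : Strategy S A) (p : ℝ)
    (ψ : List (S × A) → Ω → ℝ) :
    (M.dur p).move σ ψ = fun m ω => (1 - p) * M.stay σ ψ m ω + p * M.move σ ψ m ω := by
  funext m ω
  simp only [move, stay, dur, Finset.mul_sum, ← Finset.sum_add_distrib]
  refine Finset.sum_congr rfl fun a _ => ?_
  simp only [add_mul, mul_add, Finset.sum_add_distrib]
  simp only [mul_ite, ite_mul, mul_one, mul_zero, zero_mul, Finset.sum_ite_eq',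
    Finset.mem_univ, if_true]
  rw [add_comm]
  congr 1
  · ring
  · exact Finset.sum_congr rfl fun _ _ => by ring

/-- The expectation of `ψ` after `t` stages of the play of `M.dur p` in which the state is kept or
moves according to `M.P`, on the event that it moves `j` times. -/
def jumpExpect (M : POMDP Ω A S) (p : ℝ) (σ : Strategy S A) (j t : ℕ)
    (ψ : List (S × A) → Ω → ℝ) : ℝ :=
  listSum j fun L => ∑ ω, M.transP L ω * hiddenExpect p σ t (M.obsList L) (M.f ω) (ψ · ω)

lemma jumpExpect_zero_zero (M : POMDP Ω A S) (p : ℝ) (σ : Strategy S A)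
    (ψ : List (S × A) → Ω → ℝ) : M.jumpExpect p σ 0 0 ψ = ∑ ω, M.p1 ω * ψ [] ω := by
  simp [jumpExpect, listSum_zero, transP, hiddenExpect]

lemma jumpExpect_succ_zero (M : POMDP Ω A S) (p : ℝ) (σ : Strategy S A) (j : ℕ)
    (ψ : List (S × A) → Ω → ℝ) : M.jumpExpect p σ (j + 1) 0 ψ = 0 := by
  simp [jumpExpect, hiddenExpect, listSum]

lemma jumpExpect_zero_succ (M : POMDP Ω A S) (p : ℝ) (σ : Strategy S A) (t : ℕ)
    (ψ : List (S × A) → Ω → ℝ) :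
    M.jumpExpect p σ 0 (t + 1) ψ = (1 - p) * M.jumpExpect p σ 0 t (M.stay σ ψ) := by
  simp only [jumpExpect, listSum_zero, hiddenExpect, List.map_nil, Finset.mul_sum, stay]
  exact Finset.sum_congr rfl fun _ _ => by ring

lemma listSum_add (n : ℕ) (F G : List (Ω × A) → ℝ) :
    listSum n (fun L => F L + G L) = listSum n F + listSum n G :=
  Finset.sum_add_distrib

lemma mul_listSum (n : ℕ) (c : ℝ) (F : List (Ω × A) → ℝ) :
    c * listSum n F = listSum n fun L => c * F L :=
  Finset.mul_sum _ _ _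

lemma jumpExpect_succ_succ (M : POMDP Ω A S) (p : ℝ) (σ : Strategy S A) (j t : ℕ)
    (ψ : List (S × A) → Ω → ℝ) :
    M.jumpExpect p σ (j + 1) (t + 1) ψ =
      (1 - p) * M.jumpExpect p σ (j + 1) t (M.stay σ ψ) +
        p * M.jumpExpect p σ j t (M.move σ ψ) := by
  have hmove : ∀ L ω, hiddenExpect p σ t (M.obsList L) (M.f ω) (M.move σ ψ · ω) =
      ∑ a, ∑ ω', M.P ω a ω' * hiddenExpect p σ t (M.obsList L) (M.f ω)
        (fun m => σ (m, M.f ω) a * ψ ((M.f ω, a) :: m) ω') := by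
    intro L ω
    rw [← Fintype.sum_prod_type', ← hiddenExpect_sum]
    congr 1
    funext m
    simp only [move, Finset.mul_sum, Fintype.sum_prod_type]
    exact Finset.sum_congr rfl fun _ _ => Finset.sum_congr rfl fun _ _ => by ring
  simp only [jumpExpect, hmove]
  rw [listSum_succ, listSum_succ, mul_listSum, mul_listSum, ← listSum_add]
  congr 1
  funext L
  rw [Finset.mul_sum, Finset.mul_sum, Fintype.sum_prod_type, Fintype.sum_prod_type,
    ← Finset.sum_add_distrib]
  refine Finset.sum_congr rfl fun ω _ => ?_
  simp only [Finset.mul_sum]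
  rw [← Finset.sum_add_distrib]
  refine Finset.sum_congr rfl fun a _ => ?_
  rw [← Finset.sum_add_distrib]
  refine Finset.sum_congr rfl fun ω' _ => ?_
  simp only [transP, hiddenExpect, List.map_cons, stay]
  ring

lemma jumpExpect_eq_zero_of_lt (M : POMDP Ω A S) (p : ℝ) (σ : Strategy S A) {j t : ℕ}
    (h : t < j) (ψ : List (S × A) → Ω → ℝ) : M.jumpExpect p σ j t ψ = 0 := by
  obtain ⟨j, rfl⟩ := Nat.exists_eq_succ_of_ne_zero (by omega : j ≠ 0)
  induction t generalizing j ψ with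
  | zero => exact M.jumpExpect_succ_zero p σ j ψ
  | succ t ih =>
    obtain ⟨i, rfl⟩ := Nat.exists_eq_succ_of_ne_zero (by omega : j ≠ 0)
    rw [Nat.succ_eq_add_one, jumpExpect_succ_succ, ih _ _ (by omega), ih _ _ (by omega)]
    simp

lemma jumpExpect_linear (M : POMDP Ω A S) (p : ℝ) (σ : Strategy S A) (j t : ℕ) (c d : ℝ)
    (ψ χ : List (S × A) → Ω → ℝ) :
    M.jumpExpect p σ j t (fun m ω => c * ψ m ω + d * χ m ω) =
      c * M.jumpExpect p σ j t ψ + d * M.jumpExpect p σ j t χ := by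
  have h : ∀ L ω, hiddenExpect p σ t (M.obsList L) (M.f ω) (fun m => c * ψ m ω + d * χ m ω) =
      c * hiddenExpect p σ t (M.obsList L) (M.f ω) (ψ · ω) +
        d * hiddenExpect p σ t (M.obsList L) (M.f ω) (χ · ω) := by
    intro L ω
    have := hiddenExpect_sum (p := p) (σ := σ) Finset.univ ![c, d] ![(ψ · ω), (χ · ω)] t
      (M.obsList L) (M.f ω)
    simpa [Fin.sum_univ_two] using this
  simp only [jumpExpect, h]
  rw [mul_listSum, mul_listSum, ← listSum_add]
  congr 1
  funext L
  rw [Finset.mul_sum, Finset.mul_sum, ← Finset.sum_add_distrib]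
  exact Finset.sum_congr rfl fun _ _ => by ring

lemma expect_dur_eq_sum [DecidableEq Ω] (M : POMDP Ω A S) (p : ℝ) (σ : Strategy S A) (t : ℕ)
    (ψ : List (S × A) → Ω → ℝ) :
    (M.dur p).expect σ t ψ = ∑ j ∈ Finset.range (t + 1), M.jumpExpect p σ j t ψ := by
  induction t generalizing ψ with
  | zero =>
    rw [Finset.sum_range_one, jumpExpect_zero_zero, expect, listSum_zero]
    rfl
  | succ t ih =>
    have h : ∑ j ∈ Finset.range (t + 1), M.jumpExpect p σ j t (M.stay σ ψ) =
        ∑ j ∈ Finset.range (t + 1), M.jumpExpect p σ (j + 1) t (M.stay σ ψ) +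
          M.jumpExpect p σ 0 t (M.stay σ ψ) := by
      rw [← Finset.sum_range_succ' (fun j => M.jumpExpect p σ j t (M.stay σ ψ)),
        Finset.sum_range_succ _ (t + 1), M.jumpExpect_eq_zero_of_lt p σ t.lt_succ_self, add_zero]
    rw [expect_succ, move_dur, ih, Finset.sum_range_succ' _ (t + 1)]
    simp only [jumpExpect_linear, jumpExpect_succ_succ, jumpExpect_zero_succ,
      Finset.sum_add_distrib, ← Finset.mul_sum]
    rw [h]
    ring

lemma abs_jumpExpect_le {M : POMDP Ω A S} (hM : M.IsValid) {p : ℝ} (hp0 : 0 ≤ p) (hp1 : p ≤ 1)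
    {σ : Strategy S A} (hσ : IsStrategy σ) {ψ : List (S × A) → Ω → ℝ} {C : ℝ}
    (hψ : ∀ m ω, |ψ m ω| ≤ C) (j t : ℕ) :
    |M.jumpExpect p σ j t ψ| ≤ C * binomialWeight p t j := by
  have hq : 0 ≤ 1 - p := by linarith
  have average : ∀ (w φ : Ω → ℝ), (∀ ω, 0 ≤ w ω) → ∑ ω, w ω = 1 → (∀ ω, |φ ω| ≤ C) →
      |∑ ω, w ω * φ ω| ≤ C := fun w φ hw hw1 hφ =>
    IsStrategy.abs_sum_mul_le (σ := fun _ : Hist Unit Ω => w) ⟨fun _ => hw, fun _ => hw1⟩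
      ([], ()) hφ
  induction t generalizing j ψ with
  | zero =>
    cases j with
    | zero =>
      rw [jumpExpect_zero_zero]
      simpa [binomialWeight] using average _ _ hM.2.2.1 hM.2.2.2 (hψ [])
    | succ j => simp [jumpExpect_succ_zero, binomialWeight]
  | succ t ih =>
    have hstay : ∀ m ω, |M.stay σ ψ m ω| ≤ C := fun m ω =>
      hσ.abs_sum_mul_le _ fun a => hψ _ _
    have hmove : ∀ m ω, |M.move σ ψ m ω| ≤ C := fun m ω =>
      hσ.abs_sum_mul_le _ fun a => average _ _ (hM.1 ω a) (hM.2.1 ω a) fun ω' => hψ _ _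
    cases j with
    | zero =>
      rw [jumpExpect_zero_succ, abs_mul, abs_of_nonneg hq]
      exact (mul_le_mul_of_nonneg_left (ih hstay 0) hq).trans
        (le_of_eq (by simp only [binomialWeight]; ring))
    | succ j =>
      rw [jumpExpect_succ_succ]
      refine (abs_add_le _ _).trans ?_
      rw [abs_mul, abs_mul, abs_of_nonneg hq, abs_of_nonneg hp0]
      exact (add_le_add (mul_le_mul_of_nonneg_left (ih hstay (j + 1)) hq)
        (mul_le_mul_of_nonneg_left (ih hmove j) hp0)).trans
        (le_of_eq (by simp only [binomialWeight]; ring))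

lemma hasSum_mul_jumpExpect (M : POMDP Ω A S) {p : ℝ} (hp0 : 0 < p) (hp1 : p ≤ 1)
    {σ : Strategy S A} (hσ : IsStrategy σ) (j : ℕ) :
    HasSum (fun t => p * M.jumpExpect p σ j t (M.payoff σ))
      (M.stageE (markedStrategy p σ) j) := by
  have h : HasSum (fun t => p * M.jumpExpect p σ j t (M.payoff σ))
      (p * listSum j fun L => ∑ ω, M.transP L ω *
        ∑ a, M.g ω a * occupation p σ (M.obsList L) (M.f ω) (fun m => σ (m, M.f ω) a)) :=
    (hasSum_sum fun tr _ => hasSum_sum fun ω _ =>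
      (occupation_sum_mul hp0 hp1 hσ _ _ (M.g ω)).mul_left _).mul_left p
  convert h using 1
  rw [stageE_eq_expect, expect, mul_listSum]
  congr 1
  funext L
  rw [Finset.mul_sum]
  refine Finset.sum_congr rfl fun ω _ => ?_
  rw [← mul_transP_mul_occupation M hp0 hp1 hσ, payoff, Finset.mul_sum, Finset.mul_sum,
    Finset.mul_sum]
  refine Finset.sum_congr rfl fun a _ => ?_
  rw [← occupation_one_mul_markedStrategy hp0 hp1 hσ]
  ring

/-- A bound for the stage payoffs. -/
def payoffBound (M : POMDP Ω A S) : ℝ := ∑ ω, ∑ a, |M.g ω a|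

lemma abs_payoff_le (M : POMDP Ω A S) {σ : Strategy S A} (hσ : IsStrategy σ)
    (m : List (S × A)) (ω : Ω) : |M.payoff σ m ω| ≤ M.payoffBound :=
  hσ.abs_sum_mul_le _ fun a =>
    (Finset.single_le_sum (f := fun a => |M.g ω a|) (fun _ _ => abs_nonneg _)
      (Finset.mem_univ a)).trans
    (Finset.single_le_sum (f := fun ω => ∑ a, |M.g ω a|)
      (fun _ _ => Finset.sum_nonneg fun _ _ => abs_nonneg _) (Finset.mem_univ ω))

lemma payoffBound_nonneg (M : POMDP Ω A S) : 0 ≤ M.payoffBound :=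
  Finset.sum_nonneg fun _ _ => Finset.sum_nonneg fun _ _ => abs_nonneg _

variable [DecidableEq Ω]

lemma stageE_dur_eq_sum (M : POMDP Ω A S) (p : ℝ) (σ : Strategy S A) (t : ℕ) :
    (M.dur p).stageE σ t =
      ∑ j ∈ Finset.range (t + 1), M.jumpExpect p σ j t (M.payoff σ) := by
  rw [stageE_eq_expect, expect_dur_eq_sum]
  rfl

lemma abs_stageE_dur_le {M : POMDP Ω A S} (hM : M.IsValid) {p : ℝ} (hp0 : 0 ≤ p) (hp1 : p ≤ 1)
    {σ : Strategy S A} (hσ : IsStrategy σ) (t : ℕ) :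
    |(M.dur p).stageE σ t| ≤ M.payoffBound := by
  rw [stageE_dur_eq_sum]
  refine (Finset.abs_sum_le_sum_abs _ _).trans ((Finset.sum_le_sum fun j _ =>
    abs_jumpExpect_le hM hp0 hp1 hσ (M.abs_payoff_le hσ) j t).trans (le_of_eq ?_))
  rw [← Finset.mul_sum, binomialWeight.sum_eq_one p t.lt_succ_self, mul_one]

lemma R_dur_le {M : POMDP Ω A S} (hM : M.IsValid) {p : ℝ} (hp0 : 0 ≤ p) (hp1 : p ≤ 1)
    {σ : Strategy S A} (hσ : IsStrategy σ) : (M.dur p).R σ ≤ M.payoffBound := by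
  have h := abs_average_le M.payoffBound_nonneg (abs_stageE_dur_le hM hp0 hp1 hσ)
  exact liminf_le_of_frequently_le (Frequently.of_forall fun T => (abs_le.1 (h T)).2)
    (isBoundedUnder_of ⟨-M.payoffBound, fun T => (abs_le.1 (h T)).1⟩)

lemma R_dur_le_R_markedStrategy {M : POMDP Ω A S} (hM : M.IsValid) {p : ℝ} (hp0 : 0 < p)
    (hp1 : p ≤ 1) {σ : Strategy S A} (hσ : IsStrategy σ) :
    (M.dur p).R σ ≤ M.R (markedStrategy p σ) :=
  liminf_average_le hp0 hp1 (abs_jumpExpect_le hM hp0.le hp1 hσ (M.abs_payoff_le hσ))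
    (M.stageE_dur_eq_sum p σ) (abs_stageE_dur_le hM hp0.le hp1 hσ)
    (M.hasSum_mul_jumpExpect hp0 hp1 hσ)

end POMDP

/-- The value function `h ↦ V(h)` is nondecreasing on `(0, 1]`. -/
theorem value_monotone {Ω A S : Type*} [Fintype Ω] [Fintype A] [DecidableEq Ω]
    (M : POMDP Ω A S) (hM : M.IsValid) :
    MonotoneOn M.V (Set.Ioc (0 : ℝ) 1) := by
  rintro h ⟨h0, -⟩ k ⟨k0, k1⟩ hk
  by_cases hne : ∃ σ : Strategy S A, IsStrategy σ
  · obtain ⟨σ₀, hσ₀⟩ := hne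
    refine csSup_le ⟨_, σ₀, hσ₀, rfl⟩ ?_
    rintro _ ⟨σ, hσ, rfl⟩
    have hp0 : 0 < h / k := div_pos h0 k0
    have hp1 : h / k ≤ 1 := (div_le_one k0).2 hk
    have hR := POMDP.R_dur_le_R_markedStrategy (POMDP.isValid_dur hM k0.le k1) hp0 hp1 hσ
    rw [POMDP.dur_dur, div_mul_cancel₀ h k0.ne'] at hR
    refine hR.trans (le_csSup ⟨M.payoffBound, ?_⟩
      ⟨_, isStrategy_markedStrategy hp0 hp1 hσ, rfl⟩)
    rintro _ ⟨τ, hτ, rfl⟩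
    exact POMDP.R_dur_le hM k0.le k1 hτ
  · have hempty : ∀ d, {r | ∃ σ : Strategy S A, IsStrategy σ ∧ r = (M.dur d).R σ} = ∅ :=
      fun d => Set.eq_empty_of_forall_notMem fun r ⟨σ, hσ, _⟩ => hne ⟨σ, hσ⟩
    simp only [POMDP.V, hempty, le_refl]
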